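/- arXiv:1304.7296 — 2 statements merged into one kernel-verified Lean document; each statement's English description precedes it below -/
import Mathlib

section
/- Every empty lattice tetrahedron in ℝ³ (with respect to ℤ³) of normalized volume q > 1 is unimodularly equivalent to Δ(p,q) = conv{(0,0,0),(1,0,0),(0,0,1),(p,q,1)} for some p with 1 ≤ p ≤ q−1 and gcd(p,q)=1. -/
theorem Int.exists_sub_one_mul_lt_le_mul {c : ℤ} (hc : 0 < c)
    (t : ℤ) : ∃ k : ℤ, (k - 1) * c < t ∧ t ≤ k * c := by
  refine ⟨(t - 1) / c + 1, ?_, ?_⟩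
  · have := Int.ediv_mul_le (t - 1) hc.ne'
    rw [add_sub_cancel_right]; omega
  · have := Int.lt_ediv_add_one_mul_self (t - 1) hc
    omega

theorem false_of_floor_split_of_first {q m b c N : ℤ} (hb : 2 ≤ b) (hc : 2 ≤ c) (hm : 2 * m < q)
    (hbc : b + c = m + 1)
    (h : ∀ k : ℤ, 0 < k → k < q → k * b / q + k * c / q = k * m / q)
    (hN : (N - 1) * m < q) (hNb : q ≤ N * b) : False := by
  have hq : 0 < q := by omega
  have hle : ∀ {t x : ℤ}, t ≤ x / q ↔ t * q ≤ x := Int.le_ediv_iff_mul_le hq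
  have hlt : ∀ {t x : ℤ}, x / q < t ↔ x < t * q := Int.ediv_lt_iff_lt_mul hq
  obtain ⟨k, hk1, hk2⟩ := Int.exists_sub_one_mul_lt_le_mul (c := c) (by omega) q
  have hkpos : 2 ≤ k := by
    by_contra! hk
    nlinarith
  have hkq : k < q - 1 := by
    by_contra! hk
    nlinarith
  have hNk : N ≤ k := by
    by_contra! hk
    nlinarith
  obtain ⟨j, hj⟩ : ∃ j, j = k * b / q := ⟨_, rfl⟩
  have hj1 : 1 ≤ j := by
    rw [hj, hle]
    nlinarith
  have hjle : j * q ≤ k * b := hle.1 hj.le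
  have hjlt : k * b < (j + 1) * q := hlt.1 (by omega)
  have hck : 1 ≤ k * c / q := by rw [hle]; linarith
  have hkm : (j + 1) * q ≤ k * m := by
    rw [← hle, ← h k (by omega) (by omega)]; omega
  have hck' : (k - 1) * c / q < 1 := by rw [hlt]; linarith
  have hkb : j * q ≤ (k - 1) * b := by
    have h1 : j ≤ (k - 1) * m / q := by
      rw [hle]; nlinarith
    rw [← h (k - 1) (by omega) (by omega)] at h1
    rw [← hle]; omega
  obtain ⟨l, hl1, hl2⟩ := Int.exists_sub_one_mul_lt_le_mul (c := b) (by omega) (j * q)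
  have hlk : l ≤ k - 1 := by
    by_contra! hk
    nlinarith
  have hlpos : 1 < l := by
    by_contra! hk
    nlinarith
  have hlm : (l - 1) * m < j * q := by
    rw [← hlt, ← h (l - 1) (by omega) (by omega)]
    have h1 : (l - 1) * b / q < j := hlt.2 hl1
    have h2 : (l - 1) * c / q < 1 := by rw [hlt]; nlinarith
    omega
  rcases lt_or_ge (l + N) q with hlN | hlN
  · have h1 : (j + 1) * q ≤ (l + N) * b := by linarith
    have h2 : k ≤ l + N := by
      by_contra! hk
      nlinarith
    have h3 : 1 * q ≤ (l + N) * c := by nlinarith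
    have h4 := h (l + N) (by omega) hlN
    have h5 : (j + 2) * q ≤ (l + N) * m := by
      rw [← hle] at h1 h3 ⊢
      omega
    linarith
  · have h1 : N ≤ k - l + 1 := by
      by_contra! hk
      nlinarith
    omega

theorem false_of_floor_split {q m b c : ℤ} (hb : 2 ≤ b) (hc : 2 ≤ c) (hm : 2 * m < q)
    (hbc : b + c = m + 1)
    (h : ∀ k : ℤ, 0 < k → k < q → k * b / q + k * c / q = k * m / q) : False := by
  have hq : 0 < q := by omega
  obtain ⟨N, hN1, hN2⟩ := Int.exists_sub_one_mul_lt_le_mul (c := m) (by omega) q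
  have hNpos : 0 < N := by
    by_contra! hk
    nlinarith
  have hNq : N < q := by
    by_contra! hk
    nlinarith
  have h1 : 1 ≤ N * m / q := by rw [Int.le_ediv_iff_mul_le hq]; linarith
  rw [← h N hNpos hNq] at h1
  rcases (by omega : 1 ≤ N * b / q ∨ 1 ≤ N * c / q) with h2 | h2 <;>
    rw [Int.le_ediv_iff_mul_le hq, one_mul] at h2
  · exact false_of_floor_split_of_first hb hc hm hbc h hN1 h2
  · exact false_of_floor_split_of_first hc hb hm (by omega)
      (fun k hk hkq => by rw [add_comm]; exact h k hk hkq) hN1 h2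

theorem eq_one_or_eq_one_of_floor_sum {q a b c : ℤ} (hb : 0 < b) (hc : 0 < c)
    (haq : q < 2 * a) (habc : a + b + c = q + 1)
    (hndvd : ∀ k : ℤ, 0 < k → k < q → ¬ q ∣ k * a)
    (h : ∀ k : ℤ, 0 < k → k < q → k * a / q + k * b / q + k * c / q = k - 1) :
    b = 1 ∨ c = 1 := by
  by_contra! hne
  refine false_of_floor_split (q := q) (m := q - a) (b := b) (c := c) (by omega) (by omega)
    (by omega) (by omega) fun k hk hkq => ?_
  have hq : 0 < q := by omega
  have h1 := h k hk hkq
  have h2 : k * (q - a) / q = k - 1 - k * a / q := by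
    have h3 := Int.mul_ediv_add_emod (k * a) q
    have h4 := Int.emod_lt_of_pos (k * a) hq
    have h5 : 0 < k * a % q :=
      lt_of_le_of_ne (Int.emod_nonneg _ hq.ne') fun h0 =>
        hndvd k hk hkq (Int.dvd_of_emod_eq_zero h0.symm)
    rw [Int.ediv_eq_iff_of_pos hq]
    constructor <;> linarith
  omega

theorem exists_eq_one_of_sum_emod {q a b c : ℤ} (hq : 1 < q) (ha : 0 < a) (hb : 0 < b) (hc : 0 < c)
    (haq : a < q) (hbq : b < q) (hcq : c < q)
    (hda : ∀ k : ℤ, 0 < k → k < q → ¬ q ∣ k * a)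
    (hdb : ∀ k : ℤ, 0 < k → k < q → ¬ q ∣ k * b)
    (hdc : ∀ k : ℤ, 0 < k → k < q → ¬ q ∣ k * c)
    (h : ∀ k : ℤ, 0 < k → k < q → k * a % q + k * b % q + k * c % q = q + k) :
    a = 1 ∨ b = 1 ∨ c = 1 := by
  have habc : a + b + c = q + 1 := by
    have := h 1 one_pos hq
    rwa [one_mul, one_mul, one_mul, Int.emod_eq_of_lt ha.le haq, Int.emod_eq_of_lt hb.le hbq,
      Int.emod_eq_of_lt hc.le hcq] at this
  have hdiv : ∀ k : ℤ, 0 < k → k < q → k * a / q + k * b / q + k * c / q = k - 1 := by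
    intro k hk hkq
    have h1 := h k hk hkq
    have ha' := Int.mul_ediv_add_emod (k * a) q
    have hb' := Int.mul_ediv_add_emod (k * b) q
    have hc' := Int.mul_ediv_add_emod (k * c) q
    have h2 : q * (k * a / q + k * b / q + k * c / q) = q * (k - 1) := by
      linear_combination ha' + hb' + hc' - h1 + k * habc
    exact mul_left_cancel₀ (by omega) h2
  rcases eq_or_lt_of_le (show 2 ≤ q from hq) with rfl | hq2
  · omega
  have h2 := hdiv 2 (by norm_num) hq2
  have key : ∀ x : ℤ, (∀ k : ℤ, 0 < k → k < q → ¬ q ∣ k * x) → 1 ≤ 2 * x / q → q < 2 * x := by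
    intro x hx h1
    rw [Int.le_ediv_iff_mul_le (by omega), one_mul] at h1
    exact lt_of_le_of_ne h1 fun h0 => hx 2 (by norm_num) hq2 (h0 ▸ dvd_rfl)
  rcases (by omega : 1 ≤ 2 * a / q ∨ 1 ≤ 2 * b / q ∨ 1 ≤ 2 * c / q) with h3 | h3 | h3
  · have := eq_one_or_eq_one_of_floor_sum hb hc (key a hda h3) habc hda hdiv
    tauto
  · have := eq_one_or_eq_one_of_floor_sum ha hc (key b hdb h3) (by omega) hdb
      fun k hk hkq => by rw [← hdiv k hk hkq]; ring
    tauto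
  · have := eq_one_or_eq_one_of_floor_sum ha hb (key c hdc h3) (by omega) hdc
      fun k hk hkq => by rw [← hdiv k hk hkq]; ring
    tauto

open Matrix in
theorem Matrix.index_range_vecMulLinear {n : Type*} [Fintype n] [DecidableEq n] {V : Matrix n n ℤ}
    (hV : V.det ≠ 0) :
    (LinearMap.range V.vecMulLinear).toAddSubgroup.index = V.det.natAbs := by
  have hinj : Function.Injective V.vecMulLinear := by
    intro x y hxy
    have h : (x - y) ᵥ* V = 0 := by
      rw [Matrix.sub_vecMul, sub_eq_zero]; exact hxy
    exact sub_eq_zero.1 (Matrix.eq_zero_of_vecMul_eq_zero hV h)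
  let e := LinearEquiv.ofInjective V.vecMulLinear hinj
  have h := AddSubgroup.index_eq_natAbs_det (Pi.basisFun ℤ n)
    (LinearMap.range V.vecMulLinear).toAddSubgroup ((Pi.basisFun ℤ n).map e)
  rw [h, Pi.basisFun_det_apply]
  congr 2
  ext i j
  change (V.vecMulLinear (Pi.basisFun ℤ n i)) j = V i j
  simp

/-- The rows of `V` are the homogeneous coordinates of the vertices of an empty lattice
tetrahedron of normalized volume `q`. -/
structure IsEmptyTetrahedron (q : ℕ) (V : Matrix (Fin 4) (Fin 4) ℤ) : Prop where
  natAbs_det : V.det.natAbs = q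
  first_col : ∀ i, V i 0 = 1
  sum_ne : ∀ f z : Fin 4 → ℤ, (∀ i, 0 ≤ f i) → (∀ i, f i < q) → ∑ i, f i = q →
    Matrix.vecMul f V ≠ (q : ℤ) • z

namespace IsEmptyTetrahedron

open Matrix

variable {q : ℕ} {V : Matrix (Fin 4) (Fin 4) ℤ}

theorem submatrix (hV : IsEmptyTetrahedron q V) (σ : Equiv.Perm (Fin 4)) :
    IsEmptyTetrahedron q (V.submatrix σ id) where
  natAbs_det := by
    rw [Matrix.det_permute, Int.natAbs_mul, Int.cast_id, Int.units_natAbs, one_mul, hV.natAbs_det]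
  first_col i := hV.first_col (σ i)
  sum_ne f z hf0 hfq hf h := by
    refine hV.sum_ne (f ∘ σ.symm) z (fun i => hf0 _) (fun i => hfq _) ?_ ?_
    · rw [← hf]; exact Equiv.sum_comp σ.symm f
    · rw [← h]
      ext j
      simp only [Matrix.vecMul, dotProduct, Function.comp_apply, Matrix.submatrix_apply, id]
      exact (Equiv.sum_comp σ.symm fun i => f i * V (σ i) j) ▸ by simp

/-- The matrix of `q` times the barycentric coordinates. -/
def bary (V : Matrix (Fin 4) (Fin 4) ℤ) : Matrix (Fin 4) (Fin 4) ℤ := V.det.sign • V.adjugate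

theorem bary_mul (hV : IsEmptyTetrahedron q V) : bary V * V = (q : ℤ) • 1 := by
  rw [bary, Matrix.smul_mul, Matrix.adjugate_mul, smul_smul, Int.sign_mul_self_eq_natAbs,
    hV.natAbs_det]

theorem mul_bary (hV : IsEmptyTetrahedron q V) : V * bary V = (q : ℤ) • 1 := by
  rw [bary, Matrix.mul_smul, Matrix.mul_adjugate, smul_smul, Int.sign_mul_self_eq_natAbs,
    hV.natAbs_det]

theorem vecMul_bary_vecMul (hV : IsEmptyTetrahedron q V) (z : Fin 4 → ℤ) :
    (z ᵥ* bary V) ᵥ* V = (q : ℤ) • z := by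
  rw [Matrix.vecMul_vecMul, hV.bary_mul, Matrix.vecMul_smul, Matrix.vecMul_one]

theorem vecMul_vecMul_bary (hV : IsEmptyTetrahedron q V) (f : Fin 4 → ℤ) :
    (f ᵥ* V) ᵥ* bary V = (q : ℤ) • f := by
  rw [Matrix.vecMul_vecMul, hV.mul_bary, Matrix.vecMul_smul, Matrix.vecMul_one]

theorem emod_vecMul (hV : IsEmptyTetrahedron q V) (z : Fin 4 → ℤ) :
    ∃ y : Fin 4 → ℤ, (fun i => (z ᵥ* bary V) i % (q : ℤ)) ᵥ* V = (q : ℤ) • y := by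
  refine ⟨z - (fun i => (z ᵥ* bary V) i / (q : ℤ)) ᵥ* V, ?_⟩
  rw [smul_sub, ← hV.vecMul_bary_vecMul z, ← Matrix.smul_vecMul, ← Matrix.sub_vecMul]
  congr 1
  ext i
  simp [Int.emod_def]

theorem dvd_sum_emod (hV : IsEmptyTetrahedron q V) (z : Fin 4 → ℤ) :
    (q : ℤ) ∣ ∑ i, (z ᵥ* bary V) i % (q : ℤ) := by
  obtain ⟨y, hy⟩ := hV.emod_vecMul z
  refine ⟨y 0, ?_⟩
  have := congrFun hy 0
  simpa [Matrix.vecMul, dotProduct, hV.first_col] using this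

theorem sum_emod_ne (hV : IsEmptyTetrahedron q V) (hq : 1 < q) (z : Fin 4 → ℤ) :
    ∑ i, (z ᵥ* bary V) i % (q : ℤ) ≠ q := by
  intro h
  obtain ⟨y, hy⟩ := hV.emod_vecMul z
  exact hV.sum_ne _ y (fun i => Int.emod_nonneg _ (by omega))
    (fun i => Int.emod_lt_of_pos _ (by omega)) h hy

/-- A lattice point either lies in the sublattice spanned by the vertices, or none of its
barycentric coordinates is an integer. -/
theorem dvd_or_sum_emod (hV : IsEmptyTetrahedron q V) (hq : 1 < q) (z : Fin 4 → ℤ) :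
    (∀ i, (q : ℤ) ∣ (z ᵥ* bary V) i) ∨ ((∀ i, ¬ (q : ℤ) ∣ (z ᵥ* bary V) i) ∧
      ∑ i, (z ᵥ* bary V) i % (q : ℤ) = 2 * q) := by
  have h1 := hV.sum_emod_ne hq z
  have h2 := hV.sum_emod_ne hq (-z)
  obtain ⟨m, hm⟩ := hV.dvd_sum_emod z
  have hq0 : (0 : ℤ) < q := by omega
  rw [Matrix.neg_vecMul] at h2
  generalize z ᵥ* bary V = f at *
  simp only [Fin.sum_univ_four, Pi.neg_apply] at h1 h2 hm ⊢
  have key : ∀ i, ((q : ℤ) ∣ f i ∧ f i % q = 0 ∧ (-f i) % q = 0) ∨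
      (¬ (q : ℤ) ∣ f i ∧ 0 < f i % q ∧ f i % q < q ∧ (-f i) % q = q - f i % q) := by
    intro i
    by_cases hd : (q : ℤ) ∣ f i
    · exact Or.inl ⟨hd, Int.emod_eq_zero_of_dvd hd, Int.emod_eq_zero_of_dvd (hd.neg_right)⟩
    · refine Or.inr ⟨hd, ?_, Int.emod_lt_of_pos _ hq0, ?_⟩
      · exact lt_of_le_of_ne (Int.emod_nonneg _ hq0.ne') fun h0 =>
          hd (Int.dvd_of_emod_eq_zero h0.symm)
      · rw [Int.neg_emod, if_neg hd]; simp
  have hm0 : 0 ≤ m := by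
    have : ∀ i, 0 ≤ f i % q := fun i => Int.emod_nonneg _ hq0.ne'
    have h0 := this 0; have h1 := this 1; have h2 := this 2; have h3 := this 3
    by_contra! h
    nlinarith
  have hm4 : m < 4 := by
    have : ∀ i, f i % q < q := fun i => Int.emod_lt_of_pos _ hq0
    have h0 := this 0; have h1 := this 1; have h2 := this 2; have h3 := this 3
    by_contra! h
    nlinarith
  simp only [Fin.forall_fin_succ, IsEmpty.forall_iff, and_true]
  have k0 := key 0
  have k1 := key 1
  have k2 := key 2
  have k3 := key 3
  simp only [Fin.isValue, Fin.succ_zero_eq_one, Fin.succ_one_eq_two]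
  have e3 : (Fin.succ 2 : Fin 4) = 3 := rfl
  have hm' : m = 0 ∨ m = 1 ∨ m = 2 ∨ m = 3 := by omega
  rw [e3]
  rcases k0 with ⟨d0, k0⟩ | ⟨d0, k0⟩ <;> rcases k1 with ⟨d1, k1⟩ | ⟨d1, k1⟩ <;>
  rcases k2 with ⟨d2, k2⟩ | ⟨d2, k2⟩ <;> rcases k3 with ⟨d3, k3⟩ | ⟨d3, k3⟩ <;>
  simp only [d0, d1, d2, d3, not_true, not_false_iff, true_and, and_true, and_false, false_and,
    or_false, false_or] <;>
  rcases hm' with rfl | rfl | rfl | rfl <;> omega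

theorem dvd_of_dvd (hV : IsEmptyTetrahedron q V) (hq : 1 < q) {z : Fin 4 → ℤ} {i : Fin 4}
    (h : (q : ℤ) ∣ (z ᵥ* bary V) i) (j : Fin 4) : (q : ℤ) ∣ (z ᵥ* bary V) j :=
  (hV.dvd_or_sum_emod hq z).elim (fun h' => h' j) fun h' => absurd h (h'.1 i)

/-- Every residue class modulo `q` is attained by each barycentric coordinate. -/
theorem exists_dvd_sub_one (hV : IsEmptyTetrahedron q V) (hq : 1 < q) (i : Fin 4) :
    ∃ z : Fin 4 → ℤ, (q : ℤ) ∣ (z ᵥ* bary V) i - 1 := by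
  have : NeZero q := ⟨by omega⟩
  have hdet : V.det ≠ 0 := by
    have := hV.natAbs_det; omega
  let φ : (Fin 4 → ℤ) →+ ZMod q :=
    (Int.castAddHom (ZMod q)).comp
      ((Pi.evalAddMonoidHom (fun _ : Fin 4 => ℤ) i).comp (bary V).vecMulLinear.toAddMonoidHom)
  have hφ : ∀ z, φ z = (((z ᵥ* bary V) i : ℤ) : ZMod q) := fun _ => rfl
  have hker : φ.ker = (LinearMap.range V.vecMulLinear).toAddSubgroup := by
    ext z
    rw [AddMonoidHom.mem_ker, hφ, ZMod.intCast_zmod_eq_zero_iff_dvd]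
    constructor
    · intro h
      choose f hf using hV.dvd_of_dvd hq h
      refine ⟨f, ?_⟩
      have h1 := hV.vecMul_bary_vecMul z
      rw [show z ᵥ* bary V = (q : ℤ) • f from funext hf, Matrix.smul_vecMul] at h1
      exact smul_right_injective _ (by omega : (q : ℤ) ≠ 0) h1
    · rintro ⟨f, rfl⟩
      rw [Matrix.vecMulLinear_apply, hV.vecMul_vecMul_bary]
      exact ⟨f i, rfl⟩
  have hcard : Nat.card φ.range = Nat.card (ZMod q) := by
    rw [← AddSubgroup.index_ker, hker, Matrix.index_range_vecMulLinear hdet, hV.natAbs_det,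
      Nat.card_zmod]
  obtain ⟨z, hz⟩ := AddMonoidHom.range_eq_top.1 (AddSubgroup.eq_top_of_card_eq _ hcard) 1
  refine ⟨z, ?_⟩
  rw [← ZMod.intCast_zmod_eq_zero_iff_dvd, Int.cast_sub, ← hφ, hz]
  simp

theorem dvd_sub_mul (hV : IsEmptyTetrahedron q V) (hq : 1 < q) {y : Fin 4 → ℤ} {i : Fin 4}
    (hy : (q : ℤ) ∣ (y ᵥ* bary V) i - 1) (z : Fin 4 → ℤ) (j : Fin 4) :
    (q : ℤ) ∣ (z ᵥ* bary V) j - (z ᵥ* bary V) i * (y ᵥ* bary V) j := by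
  have h := hV.dvd_of_dvd hq (z := z - (z ᵥ* bary V) i • y) (i := i) (by
    rw [Matrix.sub_vecMul, Matrix.smul_vecMul]
    obtain ⟨t, ht⟩ := hy
    refine ⟨-(z ᵥ* bary V) i * t, ?_⟩
    simp only [Pi.sub_apply, Pi.smul_apply, smul_eq_mul]
    linear_combination -(z ᵥ* bary V) i * ht) j
  rwa [Matrix.sub_vecMul, Matrix.smul_vecMul] at h

/-- White's theorem: an empty tetrahedron has lattice width one. -/
theorem exists_dvd_add (hV : IsEmptyTetrahedron q V) (hq : 1 < q) :
    ∃ i : Fin 4, i ≠ 3 ∧ ∀ z, (q : ℤ) ∣ (z ᵥ* bary V) i + (z ᵥ* bary V) 3 := by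
  have hq0 : (0 : ℤ) < q := by omega
  obtain ⟨y, hy⟩ := hV.exists_dvd_sub_one hq 3
  obtain ⟨w, hw⟩ : ∃ w, w = (-y) ᵥ* bary V := ⟨_, rfl⟩
  have hw3 : (q : ℤ) ∣ w 3 + 1 := by
    have := hy.neg_right
    rwa [neg_sub, ← neg_add_eq_sub, ← Pi.neg_apply, ← Matrix.neg_vecMul, ← hw] at this
  have hk : ∀ k : ℤ, 0 < k → k < q → (∀ i, ¬ (q : ℤ) ∣ k * w i) ∧
      ∑ i, k * w i % (q : ℤ) = 2 * q := by
    intro k hk0 hkq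
    have h := hV.dvd_or_sum_emod hq (k • -y)
    rw [Matrix.smul_vecMul, ← hw] at h
    refine h.resolve_left fun h' => ?_
    have h1 : (q : ℤ) ∣ k := by
      have := dvd_sub (hw3.mul_left k) (h' 3)
      simpa [mul_add] using this
    exact absurd (Int.le_of_dvd hk0 h1) (by omega)
  have hk3 : ∀ k : ℤ, 0 < k → k < q → k * w 3 % q = q - k := by
    intro k hk0 hkq
    obtain ⟨t, ht⟩ := hw3
    rw [← Int.emod_eq_of_lt (a := (q : ℤ) - k) (b := q) (by omega) (by omega)]
    apply Int.ModEq.symm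
    rw [Int.modEq_iff_dvd]
    exact ⟨k * t - 1, by linear_combination k * ht⟩
  have hmod : ∀ i, ∀ k : ℤ, k * (w i % q) % q = k * w i % q :=
    fun i k => (Int.mod_modEq (w i) q).mul_left k
  have hndvd : ∀ i, ∀ k : ℤ, 0 < k → k < q → ¬ (q : ℤ) ∣ k * (w i % q) := by
    intro i k hk0 hkq h
    refine (hk k hk0 hkq).1 i ?_
    rwa [Int.dvd_iff_emod_eq_zero, hmod, ← Int.dvd_iff_emod_eq_zero] at h
  have hpos : ∀ i, 0 < w i % q := fun i =>
    lt_of_le_of_ne (Int.emod_nonneg _ hq0.ne') fun h0 =>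
      (hk 1 one_pos (by omega)).1 i (by rw [one_mul]; exact Int.dvd_of_emod_eq_zero h0.symm)
  have hlt : ∀ i, w i % q < q := fun i => Int.emod_lt_of_pos _ hq0
  have hone : ∃ i : Fin 4, i ≠ 3 ∧ w i % q = 1 := by
    rcases exists_eq_one_of_sum_emod (by omega) (hpos 0) (hpos 1) (hpos 2) (hlt 0) (hlt 1) (hlt 2)
      (hndvd 0) (hndvd 1) (hndvd 2) (fun k hk0 hkq => by
        have h1 := (hk k hk0 hkq).2
        have h2 := hk3 k hk0 hkq
        simp only [Fin.sum_univ_four] at h1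
        simp only [hmod]
        omega) with h | h | h
    exacts [⟨0, by decide, h⟩, ⟨1, by decide, h⟩, ⟨2, by decide, h⟩]
  obtain ⟨i, hi3, hi⟩ := hone
  refine ⟨i, hi3, fun z => ?_⟩
  have h1 := hV.dvd_sub_mul hq hy z i
  have h2 : (q : ℤ) ∣ w i - 1 := (Int.emod_eq_emod_iff_emod_sub_eq_zero.1
    (by rw [hi, Int.emod_eq_of_lt (by omega) (by omega)]) |> Int.dvd_of_emod_eq_zero)
  have h3 : (y ᵥ* bary V) i = - w i := by rw [hw, Matrix.neg_vecMul, Pi.neg_apply, neg_neg]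
  rw [h3] at h1
  have h4 : (q : ℤ) ∣ (z ᵥ* bary V) i - (z ᵥ* bary V) 3 * -w i - (z ᵥ* bary V) 3 * (w i - 1) :=
    Int.dvd_sub h1 (h2.mul_left _)
  convert h4 using 1
  ring

theorem exists_mulVec_eq (hV : IsEmptyTetrahedron q V) (hq : 1 < q) :
    ∃ i : Fin 4, i ≠ 3 ∧ ∃ n : Fin 4 → ℤ, V *ᵥ n = Pi.single i 1 + Pi.single 3 1 := by
  obtain ⟨i, hi, h⟩ := hV.exists_dvd_add hq
  choose n hn using fun k => h (Pi.single k 1)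
  refine ⟨i, hi, n, ?_⟩
  have h1 : (q : ℤ) • n = bary V *ᵥ (Pi.single i 1 + Pi.single 3 1) := by
    ext k
    rw [Pi.smul_apply, smul_eq_mul, ← hn]
    simp [Matrix.mulVec_add]
  have h2 : (q : ℤ) • (V *ᵥ n) = (q : ℤ) • (Pi.single i 1 + Pi.single 3 1) := by
    rw [← Matrix.mulVec_smul, h1, Matrix.mulVec_mulVec, hV.mul_bary, Matrix.smul_mulVec,
      Matrix.one_mulVec]
  exact smul_right_injective _ (by omega : (q : ℤ) ≠ 0) h2

theorem exists_normal_form (hV : IsEmptyTetrahedron q V) (hq : 1 < q) {n : Fin 4 → ℤ}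
    (hn : V *ᵥ n = ![0, 0, 1, 1]) :
    ∃ p : ℤ, 1 ≤ p ∧ p ≤ (q : ℤ) - 1 ∧ IsCoprime p (q : ℤ) ∧
      ∃ B : Matrix (Fin 4) (Fin 4) ℤ, IsUnit B.det ∧ (∀ i, B i 0 = if i = 0 then 1 else 0) ∧
        V * B = !![1, 0, 0, 0; 1, 1, 0, 0; 1, 0, 0, 1; 1, p, q, 1] := by
  have hq0 : (0 : ℤ) < q := by omega
  obtain ⟨y, hy⟩ := hV.exists_dvd_sub_one hq 3
  obtain ⟨x, hx⟩ := hV.exists_dvd_sub_one hq 1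
  have hndvd : ¬ (q : ℤ) ∣ (y ᵥ* bary V) 1 := fun h => by
    have h1 : (q : ℤ) ∣ 1 := (dvd_sub_right (hV.dvd_of_dvd hq h 3)).1 hy
    exact absurd (Int.le_of_dvd one_pos h1) (by omega)
  obtain ⟨p, hp⟩ : ∃ p, p = -(y ᵥ* bary V) 1 % q := ⟨_, rfl⟩
  have hp0 : 0 ≤ p := hp ▸ Int.emod_nonneg _ hq0.ne'
  have hpq : p < q := hp ▸ Int.emod_lt_of_pos _ hq0
  have hp1 : p ≠ 0 := fun h0 => hndvd <| by
    rw [← dvd_neg]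
    exact Int.dvd_of_emod_eq_zero (hp.symm.trans h0)
  have hpy : (q : ℤ) ∣ (y ᵥ* bary V) 1 + p := by
    have h := Int.dvd_self_sub_emod (x := -(y ᵥ* bary V) 1) (m := q)
    rw [← hp, ← neg_add', dvd_neg] at h
    exact h
  have hdvd : ∀ z, (q : ℤ) ∣ (z ᵥ* bary V) 1 + p * (z ᵥ* bary V) 3 := by
    intro z
    obtain ⟨s, hs⟩ := hV.dvd_sub_mul hq hy z 1
    obtain ⟨t, ht⟩ := hpy
    exact ⟨s + (z ᵥ* bary V) 3 * t, by linear_combination hs + (z ᵥ* bary V) 3 * ht⟩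
  refine ⟨p, by omega, by omega, ?_, ?_⟩
  · obtain ⟨s, hs⟩ := hx
    obtain ⟨t, ht⟩ := hdvd x
    exact ⟨-(x ᵥ* bary V) 3, t - s, by linear_combination hs - ht⟩
  choose m hm using fun k => hdvd (Pi.single k 1)
  simp only [Matrix.single_one_vecMul, Matrix.row_apply] at hm
  have hVm : V *ᵥ m = ![0, 1, 0, p] := by
    have h1 : (q : ℤ) • m = bary V *ᵥ ![0, 1, 0, p] := by
      ext k
      rw [Pi.smul_apply, smul_eq_mul, ← hm]
      simp [Matrix.mulVec, dotProduct, Fin.sum_univ_four, mul_comm]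
    have h2 : (q : ℤ) • (V *ᵥ m) = (q : ℤ) • ![0, 1, 0, p] := by
      rw [← Matrix.mulVec_smul, h1, Matrix.mulVec_mulVec, hV.mul_bary, Matrix.smul_mulVec,
        Matrix.one_mulVec]
    exact smul_right_injective _ hq0.ne' h2
  let B : Matrix (Fin 4) (Fin 4) ℤ :=
    (Matrix.of ![Pi.single 0 1, m, fun k => bary V k 3, n])ᵀ
  have hB : V * B = !![1, 0, 0, 0; 1, 1, 0, 0; 1, 0, 0, 1; 1, p, q, 1] := by
    have h0 : V *ᵥ Pi.single 0 1 = ![1, 1, 1, 1] := by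
      ext i
      rw [Matrix.mulVec_single_one]
      fin_cases i <;> exact hV.first_col _
    have h2 : (V *ᵥ fun k => bary V k 3) = ![0, 0, 0, (q : ℤ)] := by
      ext i
      have h := congrFun (congrFun hV.mul_bary i) 3
      refine h.trans ?_
      fin_cases i <;> simp
    ext i j
    have hcol : (V * B) i j = (V *ᵥ (fun k => B k j)) i := rfl
    rw [hcol]
    fin_cases j
    · exact (congrFun h0 i).trans (by fin_cases i <;> rfl)
    · exact (congrFun hVm i).trans (by fin_cases i <;> rfl)
    · exact (congrFun h2 i).trans (by fin_cases i <;> rfl)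
    · exact (congrFun hn i).trans (by fin_cases i <;> rfl)
  refine ⟨B, ?_, ?_, hB⟩
  · have h1 := congrArg (fun M => M.det.natAbs) hB
    have h2 : (!![1, 0, 0, 0; 1, 1, 0, 0; 1, 0, 0, 1; 1, p, q, 1] : Matrix _ _ ℤ).det = -q := by
      simp [Matrix.det_succ_row_zero, Fin.sum_univ_succ, Fin.succAbove]
    simp only [Matrix.det_mul, Int.natAbs_mul, hV.natAbs_det, h2, Int.natAbs_neg,
      Int.natAbs_natCast] at h1
    rw [Int.isUnit_iff_natAbs_eq]
    exact (Nat.mul_eq_left (by omega)).1 h1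
  · intro i
    fin_cases i <;> rfl

end IsEmptyTetrahedron

/-- The matrix whose rows are the points `v i` in homogeneous coordinates. -/
def homogenize (v : Fin 4 → Fin 3 → ℤ) : Matrix (Fin 4) (Fin 4) ℤ :=
  Matrix.of fun i => Matrix.vecCons 1 (v i)

theorem det_homogenize (v : Fin 4 → Fin 3 → ℤ) :
    (homogenize v).det =
      (Matrix.of fun i j : Fin 3 => v i.succ j - v 0 j).det := by
  rw [← Matrix.det_eq_of_forall_row_eq_smul_add_const (A := Matrix.of fun i : Fin 4 =>
      (Fin.cons (Matrix.vecCons 1 (v 0))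
        (fun i : Fin 3 => Matrix.vecCons 0 (v i.succ - v 0)) :
        Fin 4 → Fin 4 → ℤ) i) (B := homogenize v) (Fin.cons 0 fun _ => -1) 0 rfl ?_]
  · rw [Matrix.det_succ_column_zero, Fin.sum_univ_succ]
    simp
    rfl
  · intro i j
    refine Fin.cases ?_ (fun i => ?_) i <;> refine Fin.cases ?_ (fun j => ?_) j <;>
      simp [homogenize, sub_eq_add_neg]

theorem isEmptyTetrahedron_homogenize {q : ℕ} (hq : 1 < q) {v : Fin 4 → Fin 3 → ℤ}
    (hvol : (Matrix.det (Matrix.of fun i j : Fin 3 => (v i.succ j - v 0 j))).natAbs = q)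
    (hempty : ∀ x : Fin 3 → ℤ,
      (fun i => (x i : ℝ)) ∈ convexHull ℝ (Set.range fun i => fun j => ((v i j : ℝ))) →
      ∃ i, x = v i) :
    IsEmptyTetrahedron q (homogenize v) where
  natAbs_det := by rw [det_homogenize, hvol]
  first_col _ := rfl
  sum_ne f z hf0 hfq hf h := by
    have hqR : (0 : ℝ) < q := by exact_mod_cast (by omega : 0 < q)
    have hz0 : z 0 = 1 := by
      have h1 := congrFun h 0
      have h2 : ∑ i, f i = (q : ℤ) * z 0 := by
        simpa [Matrix.vecMul, dotProduct, homogenize] using h1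
      rw [hf] at h2
      exact (mul_eq_left₀ (by omega)).1 h2.symm
    have hx : ∀ j : Fin 3, ∑ i, f i * v i j = (q : ℤ) * z j.succ := fun j => by
      have h1 := congrFun h j.succ
      simpa [Matrix.vecMul, dotProduct, homogenize] using h1
    obtain ⟨k, hk⟩ := hempty (fun j => z j.succ) (by
      have hmem : ∑ i, ((f i : ℝ) / q) • (fun j => (v i j : ℝ)) ∈
          convexHull ℝ (Set.range fun i => fun j => ((v i j : ℝ))) := by
        refine (convex_convexHull ℝ _).sum_mem (fun i _ => ?_) ?_ fun i _ =>
          subset_convexHull ℝ _ ⟨i, rfl⟩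
        · exact div_nonneg (by exact_mod_cast hf0 i) hqR.le
        · rw [← Finset.sum_div, div_eq_one_iff_eq hqR.ne']
          exact_mod_cast hf
      convert hmem using 1
      ext j
      have h1 : (∑ i, (f i : ℝ) * v i j) = q * z j.succ := by exact_mod_cast hx j
      simp only [Finset.sum_apply, Pi.smul_apply, smul_eq_mul, div_mul_eq_mul_div]
      rw [← Finset.sum_div, h1]
      field_simp)
    have hzk : z = homogenize v k := by
      ext j
      refine Fin.cases hz0 (fun j => ?_) j
      exact congrFun hk j
    have h3 : Matrix.vecMul (f - Pi.single k (q : ℤ)) (homogenize v) = 0 := by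
      rw [Matrix.sub_vecMul, h, hzk, Matrix.single_vecMul, sub_eq_zero]
      rfl
    have hdet : (homogenize v).det ≠ 0 := by
      rw [det_homogenize]; omega
    have h4 := congrFun (Matrix.eq_zero_of_vecMul_eq_zero hdet h3) k
    have h5 := hfq k
    simp at h4
    omega

/-- Every empty lattice tetrahedron in `ℝ³` of normalized volume `q > 1`
is unimodularly equivalent to `Δ(p,q) = conv{(0,0,0),(1,0,0),(0,0,1),(p,q,1)}`
for some `p` with `1 ≤ p ≤ q-1` and `gcd(p,q) = 1`. -/
theorem empty_tetrahedron_classification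
    (q : ℕ) (hq : 1 < q) (v : Fin 4 → (Fin 3 → ℤ))
    (haff : AffineIndependent ℝ fun i => fun j => ((v i j : ℝ)))
    (hvol : (Matrix.det (Matrix.of fun i j : Fin 3 => (v i.succ j - v 0 j))).natAbs = q)
    (hempty : ∀ x : Fin 3 → ℤ,
      (fun i => (x i : ℝ)) ∈ convexHull ℝ (Set.range fun i => fun j => ((v i j : ℝ))) →
      ∃ i, x = v i) :
    ∃ p : ℤ, 1 ≤ p ∧ p ≤ (q : ℤ) - 1 ∧ IsCoprime p (q : ℤ) ∧
      ∃ (A : Matrix (Fin 3) (Fin 3) ℤ) (b : Fin 3 → ℤ), IsUnit A.det ∧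
        (fun x : Fin 3 → ℤ => A.mulVec x + b) '' Set.range v =
          ({![0,0,0], ![1,0,0], ![0,0,1], ![p, (q : ℤ), 1]} : Set (Fin 3 → ℤ)) := by
  have hV := isEmptyTetrahedron_homogenize hq hvol hempty
  obtain ⟨i, hi, n, hn⟩ := hV.exists_mulVec_eq hq
  let σ : Equiv.Perm (Fin 4) := Equiv.swap i 2
  have hn' : ((homogenize v).submatrix σ id).mulVec n = ![0, 0, 1, 1] := by
    have h : ((homogenize v).submatrix σ id).mulVec n = (homogenize v).mulVec n ∘ σ := rfl
    have hswap : ∀ i : Fin 4, i ≠ 3 → ∀ k : Fin 4,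
        (Pi.single i 1 + Pi.single 3 1 : Fin 4 → ℤ) (Equiv.swap i 2 k) =
          (![0, 0, 1, 1] : Fin 4 → ℤ) k := by decide
    rw [h, hn]
    exact funext (hswap i hi)
  obtain ⟨p, hp1, hpq, hcop, B, hdet, hB0, hB⟩ := (hV.submatrix σ).exists_normal_form hq hn'
  let A : Matrix (Fin 3) (Fin 3) ℤ := Matrix.of fun i j => B j.succ i.succ
  let b : Fin 3 → ℤ := fun i => B 0 i.succ
  refine ⟨p, hp1, hpq, hcop, A, b, ?_, ?_⟩
  · rw [Matrix.det_succ_column_zero, Fin.sum_univ_succ] at hdet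
    simp only [hB0, Fin.succ_ne_zero, if_false, if_true, mul_zero, zero_mul,
      Finset.sum_const_zero, add_zero, Fin.val_zero, pow_zero, one_mul] at hdet
    rw [← Matrix.det_transpose]
    exact hdet
  · have himage : ∀ k j, (A.mulVec (v (σ k)) + b) j =
        !![1, 0, 0, 0; 1, 1, 0, 0; 1, 0, 0, 1; 1, p, (q : ℤ), 1] k j.succ := by
      intro k j
      rw [← hB, Matrix.mul_apply, Fin.sum_univ_succ, add_comm]
      simp [A, b, Matrix.mulVec, dotProduct, homogenize, mul_comm]
    rw [← σ.surjective.range_comp v, ← Set.range_comp]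
    have h4 : ∀ g : Fin 4 → Fin 3 → ℤ, Set.range g = {g 0, g 1, g 2, g 3} := by
      intro g
      ext x
      simp [Fin.exists_fin_succ, eq_comm]
    rw [h4]
    congr 1
    · ext j
      exact (himage 0 j).trans (by fin_cases j <;> rfl)
    congr 1
    · ext j
      exact (himage 1 j).trans (by fin_cases j <;> rfl)
    congr 1
    · ext j
      exact (himage 2 j).trans (by fin_cases j <;> rfl)
    congr 1
    ext j
    exact (himage 3 j).trans (by fin_cases j <;> rfl)
end

section
/- Every empty lattice tetrahedron in ℝ³ has lattice width 1: there exists a nonzero linear functional f : ℤ³ → ℤ such that the values of f on the four vertices take exactly two values, which are consecutive integers. Moreover f can be chosen constant on each of a pair of opposite edges. -/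
/-- The identities `⌊ka/n⌋ + ⌊kb/n⌋ + ⌊kc/n⌋ = k - 1` for `0 < k < n` cannot all hold when
`a + b + c = n + 1`, `2a ≥ n` and `2 ≤ c ≤ b`. The proof compares the jumps of `⌊kd/n⌋`, where
`d = n - a`, with those of `⌊kb/n⌋ + ⌊kc/n⌋`. -/
lemma false_of_floor_sum_of_le_two_mul {n a b c : ℤ} (hb : 2 ≤ b) (hc : 2 ≤ c)
    (habc : a + b + c = n + 1) (ha : n ≤ 2 * a) (hcb : c ≤ b)
    (hne : ∀ k, 1 ≤ k → k < n → ¬ n ∣ k * a)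
    (hfl : ∀ k, 1 ≤ k → k < n → k * a / n + k * b / n + k * c / n = k - 1) : False := by
  have hn : 0 < n := by lia
  have hn3 : 3 ≤ n := by lia
  obtain ⟨d, hd⟩ : ∃ d, d = n - a := ⟨_, rfl⟩
  have hsplit : ∀ k, 0 ≤ k → k < n → k * d / n = k * b / n + k * c / n := by
    intro k hk hkn
    rcases hk.eq_or_lt with rfl | hk
    · simp
    have h1 := hfl k hk hkn
    have h2 : k * d / n = k - 1 - k * a / n := by
      have hr : k * a % n ≠ 0 := fun h => hne k hk hkn (Int.dvd_of_emod_eq_zero h)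
      have hr0 := Int.emod_nonneg (k * a) hn.ne'
      have hr1 := Int.emod_lt_of_pos (k * a) hn
      have hdiv := Int.emod_add_mul_ediv (k * a) n
      have hkd : k * d = (n - k * a % n) + n * (k - 1 - k * a / n) := by
        subst hd; linear_combination hdiv
      rw [hkd, Int.add_mul_ediv_left _ _ hn.ne', Int.ediv_eq_zero_of_lt (by lia) (by lia), zero_add]
    lia
  have h2d : 2 * d < n := by
    have h := hne 2 (by lia) (by lia)
    have : n ≠ 2 * a := fun h' => h (by rw [← h'])
    lia
  have hd3 : 3 ≤ d := by lia
  obtain ⟨q, hq⟩ : ∃ q, q = n / d := ⟨_, rfl⟩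
  have hq1 : q * d ≤ n := hq ▸ Int.ediv_mul_le n (by lia)
  have hq2 : n < (q + 1) * d := hq ▸ Int.lt_ediv_add_one_mul_self n (by lia)
  have hqge : 2 ≤ q := by
    rw [hq, Int.le_ediv_iff_mul_le (by lia)]; lia
  have hq3 : 3 * q ≤ n := by nlinarith
  -- `b` attains the first jump of `d`
  have hbq : n ≤ (q + 1) * b := by
    by_contra! hlt
    have h := hsplit (q + 1) (by lia) (by lia)
    have h1 : (q + 1) * b / n = 0 := Int.ediv_eq_zero_of_lt (by nlinarith) hlt
    have h2 : (q + 1) * c / n = 0 := Int.ediv_eq_zero_of_lt (by nlinarith) (by nlinarith)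
    have h3 : 1 ≤ (q + 1) * d / n := by rw [Int.le_ediv_iff_mul_le hn]; lia
    lia
  -- `m + 1` is the first jump of `c`
  obtain ⟨m, hm⟩ : ∃ m, m = (n - 1) / c := ⟨_, rfl⟩
  have hm1 : m * c ≤ n - 1 := hm ▸ Int.ediv_mul_le (n - 1) (by lia)
  have hm2 : n - 1 < (m + 1) * c := hm ▸ Int.lt_ediv_add_one_mul_self (n - 1) (by lia)
  have hmge : 1 ≤ m := by
    rw [hm, Int.le_ediv_iff_mul_le (by lia)]; lia
  have hm3 : 2 * m ≤ n - 1 := by nlinarith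
  have c0 : m * c / n = 0 := Int.ediv_eq_zero_of_lt (by nlinarith) (by lia)
  have c1 : 1 ≤ (m + 1) * c / n := by rw [Int.le_ediv_iff_mul_le hn]; lia
  have c2 : 1 ≤ (m + q) * c / n := by rw [Int.le_ediv_iff_mul_le hn]; nlinarith
  have c3 : (m - 1) * c / n = 0 := Int.ediv_eq_zero_of_lt (by nlinarith) (by nlinarith)
  have b1 : m * b / n ≤ (m + 1) * b / n := Int.ediv_le_ediv hn (by nlinarith)
  have b2 : (m - 1) * b / n + 1 ≤ (m + q) * b / n := by
    rw [Int.le_ediv_iff_mul_le hn]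
    have := Int.ediv_mul_le ((m - 1) * b) hn.ne'
    nlinarith
  have s0 := hsplit m (by lia) (by lia)
  have s1 := hsplit (m + 1) (by lia) (by lia)
  have s2 := hsplit (m - 1) (by lia) (by lia)
  have s3 := hsplit (m + q) (by lia) (by lia)
  have d0 : m * d < (m * d / n + 1) * n := Int.lt_ediv_add_one_mul_self _ hn
  have d1 : (m * d / n + 1) * n ≤ (m + 1) * d := by
    rw [← Int.le_ediv_iff_mul_le hn]; lia
  have d2 : m * d / n ≤ (m - 1) * d / n := by
    rw [Int.le_ediv_iff_mul_le hn]; nlinarith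
  have d3 : (m + q) * d / n < m * d / n + 2 := by
    rw [Int.ediv_lt_iff_lt_mul hn]; nlinarith
  lia

/-- The arithmetic core of White's theorem. -/
lemma eq_one_of_floor_sum {n a b c : ℤ} (ha : 1 ≤ a) (hb : 1 ≤ b) (hc : 1 ≤ c)
    (habc : a + b + c = n + 1)
    (hna : ∀ k, 1 ≤ k → k < n → ¬ n ∣ k * a)
    (hnb : ∀ k, 1 ≤ k → k < n → ¬ n ∣ k * b)
    (hnc : ∀ k, 1 ≤ k → k < n → ¬ n ∣ k * c)
    (hfl : ∀ k, 1 ≤ k → k < n → k * a / n + k * b / n + k * c / n = k - 1) :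
    a = 1 ∨ b = 1 ∨ c = 1 := by
  by_contra! hne
  obtain ⟨ha1, hb1, hc1⟩ := hne
  have hn : 0 < n := by lia
  have hbig : n ≤ 2 * a ∨ n ≤ 2 * b ∨ n ≤ 2 * c := by
    by_contra! h
    have h2 := hfl 2 (by lia) (by lia)
    rw [Int.ediv_eq_zero_of_lt (by lia) h.1, Int.ediv_eq_zero_of_lt (by lia) h.2.1,
      Int.ediv_eq_zero_of_lt (by lia) h.2.2] at h2
    lia
  rcases hbig with h | h | h
  · rcases le_total c b with h' | h'
    · exact false_of_floor_sum_of_le_two_mul (by lia) (by lia)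
        (by lia) h h' hna hfl
    · exact false_of_floor_sum_of_le_two_mul (a := a) (b := c) (c := b) (by lia) (by lia)
        (by lia) h h' hna fun k h1 h2 => by have := hfl k h1 h2; lia
  · rcases le_total c a with h' | h'
    · exact false_of_floor_sum_of_le_two_mul (a := b) (b := a) (c := c) (by lia) (by lia)
        (by lia) h h' hnb fun k h1 h2 => by have := hfl k h1 h2; lia
    · exact false_of_floor_sum_of_le_two_mul (a := b) (b := c) (c := a) (by lia) (by lia)
        (by lia) h h' hnb fun k h1 h2 => by have := hfl k h1 h2; lia
  · rcases le_total b a with h' | h'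
    · exact false_of_floor_sum_of_le_two_mul (a := c) (b := a) (c := b) (by lia) (by lia)
        (by lia) h h' hnc fun k h1 h2 => by have := hfl k h1 h2; lia
    · exact false_of_floor_sum_of_le_two_mul (a := c) (b := b) (c := a) (by lia) (by lia)
        (by lia) h h' hnc fun k h1 h2 => by have := hfl k h1 h2; lia

/-- The fractional-part form of `eq_one_of_floor_sum`. -/
lemma dvd_sub_one_of_emod_sum {n a b c : ℤ} (hn : 2 ≤ n)
    (hne : ∀ k, 1 ≤ k → k < n → ¬ n ∣ k * a ∧ ¬ n ∣ k * b ∧ ¬ n ∣ k * c)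
    (hsum : ∀ k, 1 ≤ k → k < n → k * a % n + k * b % n + k * c % n = n + k) :
    n ∣ a - 1 ∨ n ∣ b - 1 ∨ n ∣ c - 1 := by
  have hn0 : 0 < n := by lia
  have pos : ∀ x : ℤ, ¬ n ∣ 1 * x → 1 ≤ x % n := fun x hx => by
    have h0 := Int.emod_nonneg x hn0.ne'
    have : x % n ≠ 0 := fun h => hx (by rw [one_mul]; exact Int.dvd_of_emod_eq_zero h)
    lia
  have red : ∀ k x : ℤ, ¬ n ∣ k * x → ¬ n ∣ k * (x % n) := fun k x hx h => hx <| by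
    rw [Int.dvd_iff_emod_eq_zero] at h ⊢
    simpa [Int.mul_emod] using h
  have h1 := hne 1 le_rfl (by lia)
  have hs1 := hsum 1 le_rfl (by lia)
  simp only [one_mul] at hs1
  have key := eq_one_of_floor_sum (pos a h1.1) (pos b h1.2.1) (pos c h1.2.2) hs1
    (fun k hk hk' => red k a (hne k hk hk').1) (fun k hk hk' => red k b (hne k hk hk').2.1)
    (fun k hk hk' => red k c (hne k hk hk').2.2) (fun k hk hk' => by
      have hs := hsum k hk hk'
      have e : ∀ x : ℤ, k * (x % n) = k * x % n + n * (k * (x % n) / n) := fun x => by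
        have := Int.emod_add_mul_ediv (k * (x % n)) n
        rw [show k * (x % n) % n = k * x % n by simp [Int.mul_emod]] at this
        exact this.symm
      have ea := e a
      have eb := e b
      have ec := e c
      refine mul_left_cancel₀ hn0.ne' ?_
      linear_combination -ea - eb - ec - hs + k * hs1)
  have fin : ∀ x : ℤ, x % n = 1 → n ∣ x - 1 := fun x hx => by
    have := Int.dvd_self_sub_emod (x := x) (m := n)
    rwa [hx] at this
  exact key.imp (fin a) (Or.imp (fin b) (fin c))

section Residues

variable {A : AddSubgroup (Fin 4 → ℤ)} {N : ℤ}

/-- The residues of `-x` and `x` modulo `N` add up to `0` or `N`. -/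
lemma emod_neg_cases (hN : 0 < N) (x : ℤ) :
    x % N = 0 ∧ (-x) % N = 0 ∨ 0 < x % N ∧ x % N < N ∧ (-x) % N = N - x % N := by
  have h0 := Int.emod_nonneg x hN.ne'
  have h1 := Int.emod_lt_of_pos x hN
  rcases h0.eq_or_lt with h | h
  · exact Or.inl ⟨h.symm, Int.emod_eq_zero_of_dvd ((Int.dvd_of_emod_eq_zero h.symm).neg_right)⟩
  · refine Or.inr ⟨h, h1, ?_⟩
    have : -x = (N - x % N) + N * (-1 - x / N) := by
      linear_combination Int.emod_add_mul_ediv x N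
    conv_lhs => rw [this]
    rw [Int.add_mul_emod_self_left, Int.emod_eq_of_lt (by lia) (by lia)]

/-- The sum of the residues of a vector with zero sum is a multiple of the modulus. -/
lemma exists_sum_emod_eq {a : Fin 4 → ℤ} (h : ∑ i, a i = 0) : ∃ t, ∑ i, a i % N = N * t := by
  refine ⟨-∑ i, a i / N, ?_⟩
  have : ∑ i, a i % N + N * ∑ i, a i / N = ∑ i, a i := by
    rw [Finset.mul_sum, ← Finset.sum_add_distrib]
    exact Finset.sum_congr rfl fun i _ => Int.emod_add_mul_ediv _ _
  linear_combination this + h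

/-- In the residue group of an empty tetrahedron, the residues of a vector either vanish, or
none of them does and they add up to twice the modulus. -/
lemma forall_dvd_or_sum_emod_eq (hN : 0 < N) (hsum : ∀ a ∈ A, ∑ i, a i = 0)
    (hE : ∀ a ∈ A, ∑ i, a i % N = N → ∀ i, N ∣ a i) {a : Fin 4 → ℤ} (ha : a ∈ A) :
    (∀ i, N ∣ a i) ∨ (∀ i, ¬ N ∣ a i) ∧ ∑ i, a i % N = 2 * N := by
  have hE1 := hE a ha
  have hE2 := hE (-a) (neg_mem ha)
  obtain ⟨t, ht⟩ := exists_sum_emod_eq (N := N) (hsum a ha)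
  have c0 := emod_neg_cases hN (a 0)
  have c1 := emod_neg_cases hN (a 1)
  have c2 := emod_neg_cases hN (a 2)
  have c3 := emod_neg_cases hN (a 3)
  have hall : ∀ p : Fin 4 → Prop, (∀ i, p i) ↔ p 0 ∧ p 1 ∧ p 2 ∧ p 3 := fun p =>
    ⟨fun h => ⟨h 0, h 1, h 2, h 3⟩, fun h i => by fin_cases i <;> tauto⟩
  simp only [Pi.neg_apply, dvd_neg, Int.dvd_iff_emod_eq_zero, Fin.sum_univ_four, hall]
    at hE1 hE2 ht ⊢
  clear hE hsum hall
  have t0 : -1 < t := by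
    by_contra! h
    have : N * t ≤ N * -1 := by gcongr
    lia
  have t4 : t < 4 := by
    by_contra! h
    have : N * 4 ≤ N * t := by gcongr
    lia
  generalize a 0 % N = r₀ at *
  generalize a 1 % N = r₁ at *
  generalize a 2 % N = r₂ at *
  generalize a 3 % N = r₃ at *
  generalize -a 0 % N = s₀ at *
  generalize -a 1 % N = s₁ at *
  generalize -a 2 % N = s₂ at *
  generalize -a 3 % N = s₃ at *
  interval_cases t <;> omega

/-- In the residue group of an empty tetrahedron, two coordinates are opposite. -/
lemma exists_dvd_add (hN : 0 < N) (hsum : ∀ a ∈ A, ∑ i, a i = 0)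
    (hE : ∀ a ∈ A, ∑ i, a i % N = N → ∀ i, N ∣ a i) (hA : ∃ a ∈ A, a 0 = N) :
    ∃ i, i ≠ 0 ∧ ∀ a ∈ A, N ∣ a 0 + a i := by
  have hdich := fun a (ha : a ∈ A) => forall_dvd_or_sum_emod_eq hN hsum hE ha
  have hinj : ∀ a ∈ A, ∀ i, N ∣ a i → ∀ j, N ∣ a j := fun a ha i hi =>
    (hdich a ha).resolve_right fun h => h.1 i hi
  obtain ⟨x, hx, g, hg, hx0, hgen⟩ : ∃ x ∈ A, ∃ g : ℤ, 0 < g ∧ x 0 = -g ∧ ∀ a ∈ A, g ∣ a 0 := by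
    obtain ⟨h, hh⟩ := Int.subgroup_cyclic (A.map (Pi.evalAddMonoidHom (fun _ : Fin 4 => ℤ) 0))
    rw [← AddSubgroup.zmultiples_eq_closure] at hh
    have hdvd : ∀ a ∈ A, h ∣ a 0 := fun a ha => by
      rw [← Int.mem_zmultiples_iff, ← hh]
      exact ⟨a, ha, rfl⟩
    obtain ⟨x, hx, hxh⟩ : h ∈ A.map (Pi.evalAddMonoidHom (fun _ : Fin 4 => ℤ) 0) := by
      rw [hh]; exact AddSubgroup.mem_zmultiples h
    change x 0 = h at hxh
    have h0 : h ≠ 0 := by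
      obtain ⟨a, ha, haN⟩ := hA
      rintro rfl
      have := hdvd a ha
      rw [haN, zero_dvd_iff] at this
      lia
    rcases lt_or_gt_of_ne h0 with h' | h'
    · exact ⟨x, hx, -h, by lia, by lia, fun a ha => (neg_dvd.2 (hdvd a ha))⟩
    · exact ⟨-x, neg_mem hx, h, h', by simp [hxh], hdvd⟩
  obtain ⟨n, rfl⟩ : g ∣ N := by
    obtain ⟨a, ha, haN⟩ := hA
    exact haN ▸ hgen a ha
  have hn : 0 < n := pos_of_mul_pos_right hN hg.le
  have hmul : ∀ k : ℤ, k • x ∈ A := fun k => zsmul_mem hx k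
  have hcong : ∀ a ∈ A, ∃ k : ℤ, ∀ i, g * n ∣ a i - k * x i := fun a ha => by
    obtain ⟨k, hk⟩ := hgen a ha
    refine ⟨-k, fun i => ?_⟩
    have := hinj _ (sub_mem ha (hmul (-k))) 0 (by simp [hx0, hk, mul_comm]) i
    simpa using this
  have hxg : ∀ i, g ∣ x i := fun i => by
    have := hinj _ (hmul n) 0 (by simp [hx0, mul_comm]) i
    rw [Pi.smul_apply, smul_eq_mul, mul_comm g] at this
    exact Int.dvd_of_mul_dvd_mul_left hn.ne' this
  choose z hz using hxg
  suffices h : ∃ i, i ≠ 0 ∧ n ∣ z i - 1 by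
    obtain ⟨i, hi, hzi⟩ := h
    refine ⟨i, hi, fun a ha => ?_⟩
    obtain ⟨k, hk⟩ := hcong a ha
    have h1 : g * n ∣ x 0 + x i := by
      rw [hx0, hz i, show -g + g * z i = g * (z i - 1) by ring]
      exact mul_dvd_mul_left g hzi
    have h2 := dvd_add (dvd_add (hk 0) (hk i)) (h1.mul_left k)
    rwa [show a 0 - k * x 0 + (a i - k * x i) + k * (x 0 + x i) = a 0 + a i by ring] at h2
  rcases (show 1 ≤ n from hn).eq_or_lt with rfl | hn2
  · exact ⟨1, by decide, one_dvd _⟩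
  have hz0 : z 0 = -1 := by
    have := hz 0
    rw [hx0] at this
    exact mul_left_cancel₀ hg.ne' (by linear_combination -this)
  have key : ∀ k, 1 ≤ k → k < n → (∀ i, ¬ n ∣ k * z i) ∧ ∑ i, k * z i % n = 2 * n := by
    intro k hk hkn
    have e : ∀ i, (k • x) i = g * (k * z i) := fun i => by
      rw [Pi.smul_apply, smul_eq_mul, hz i]; ring
    rcases hdich _ (hmul k) with h | ⟨h, h'⟩
    · have h0 := h 0
      rw [e, hz0, mul_neg_one] at h0
      have := Int.le_of_dvd hk (Int.dvd_neg.1 (Int.dvd_of_mul_dvd_mul_left hg.ne' h0))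
      lia
    · simp only [e, Int.mul_emod_mul_of_pos _ _ hg, ← Finset.mul_sum] at h'
      refine ⟨fun i hi => h i (e i ▸ mul_dvd_mul_left g hi), ?_⟩
      exact mul_left_cancel₀ hg.ne' (by linear_combination h')
  have := dvd_sub_one_of_emod_sum (a := z 1) (b := z 2) (c := z 3) hn2
    (fun k hk hkn => ⟨(key k hk hkn).1 1, (key k hk hkn).1 2, (key k hk hkn).1 3⟩)
    (fun k hk hkn => by
      have h := (key k hk hkn).2
      have h0 : k * z 0 % n = n - k := by
        rw [hz0, show k * -1 = (n - k) + n * (-1) by ring, Int.add_mul_emod_self_left,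
          Int.emod_eq_of_lt (by lia) (by lia)]
      rw [Fin.sum_univ_four, h0] at h
      lia)
  rcases this with h | h | h
  exacts [⟨1, by decide, h⟩, ⟨2, by decide, h⟩, ⟨3, by decide, h⟩]

end Residues

open Matrix in
/-- Integral barycentric coordinates of a lattice tetrahedron: integer functionals `W i` which are
`N` times the linear parts of the barycentric coordinates. -/
lemma exists_barycentric_functionals (v : Fin 4 → Fin 3 → ℤ)
    (haff : AffineIndependent ℝ fun i => fun j => ((v i j : ℝ))) :
    ∃ N : ℤ, 0 < N ∧ ∃ W : Fin 4 → Fin 3 → ℤ,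
      (∀ i j k, W i ⬝ᵥ v j - W i ⬝ᵥ v k =
        N * ((Pi.single j 1 : Fin 4 → ℤ) i - (Pi.single k 1 : Fin 4 → ℤ) i)) ∧
      ∑ i, W i = 0 ∧ ∀ x, ∑ i, (W i ⬝ᵥ x) • v i = N • x := by
  obtain ⟨M, hM⟩ : ∃ M : Matrix (Fin 3) (Fin 3) ℤ, ∀ i j, M i j = v i.succ j - v 0 j :=
    ⟨fun i => v i.succ - v 0, fun _ _ => rfl⟩
  have hdet : M.det ≠ 0 := by
    intro h0
    obtain ⟨c, hc, hcM⟩ := Matrix.exists_vecMul_eq_zero_iff.2 h0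
    rw [affineIndependent_iff] at haff
    have := haff Finset.univ (Fin.cons (-∑ i, (c i : ℝ)) fun i => (c i : ℝ))
      (by simp [Fin.sum_univ_succ]) (by
        ext j
        have hj := congrFun hcM j
        simp only [Matrix.vecMul, dotProduct, hM, Fin.sum_univ_three, Pi.zero_apply] at hj
        have hj' :
            (c 0 * (v 1 j - v 0 j) + c 1 * (v 2 j - v 0 j) + c 2 * (v 3 j - v 0 j) : ℝ) = 0 := by
          exact_mod_cast hj
        rw [Fin.sum_univ_succ]
        simp [Fin.sum_univ_three]
        linear_combination hj')
    refine hc (funext fun i => ?_)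
    simpa using this i.succ (Finset.mem_univ _)
  obtain ⟨s, hsN⟩ : ∃ s : ℤ, 0 < s * M.det :=
    ⟨M.det, mul_self_pos.2 hdet⟩
  set U : Fin 3 → Fin 3 → ℤ := fun i => s • M.adjugateᵀ i with hU
  have hUx : ∀ i x, U i ⬝ᵥ x = s * (x ᵥ* M.adjugate) i := fun i x => by
    rw [hU, smul_dotProduct, dotProduct_comm, smul_eq_mul]; rfl
  have hUv : ∀ i k, U i ⬝ᵥ (v (Fin.succ k) - v 0) = s * M.det * (Pi.single k 1 : Fin 3 → ℤ) i := by
    intro i k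
    have : (M * M.adjugate) k i = (M.det • (1 : Matrix (Fin 3) (Fin 3) ℤ)) k i := by
      rw [Matrix.mul_adjugate]
    have hrow : v (Fin.succ k) - v 0 = M k := funext fun j => (hM k j).symm
    rw [hUx, mul_assoc, hrow]
    congr 1
    change (M * M.adjugate) k i = _
    simp [this, Matrix.one_apply, Pi.single_apply, eq_comm]
  refine ⟨s * M.det, hsN, Fin.cons (-∑ i, U i) U, ?_, ?_, ?_⟩
  · have base : ∀ i j, (Fin.cons (-∑ i, U i) U : Fin 4 → Fin 3 → ℤ) i ⬝ᵥ (v j - v 0) =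
        s * M.det * ((Pi.single j 1 : Fin 4 → ℤ) i - (Pi.single 0 1 : Fin 4 → ℤ) i) := by
      intro i j
      induction j using Fin.cases with
      | zero => simp
      | succ k =>
        induction i using Fin.cases with
        | zero =>
          rw [Fin.cons_zero, neg_dotProduct, sum_dotProduct]
          simp_rw [hUv]
          simp [← Finset.mul_sum]
        | succ i => simp [hUv, Pi.single_apply, Fin.succ_ne_zero]
    intro i j k
    have h1 := base i j
    have h2 := base i k
    rw [dotProduct_sub] at h1 h2
    linear_combination h1 - h2
  · simp [Fin.sum_univ_succ]
  · intro x
    have h : (x ᵥ* M.adjugate) ᵥ* M = M.det • x := by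
      rw [Matrix.vecMul_vecMul, Matrix.adjugate_mul, Matrix.vecMul_smul, Matrix.vecMul_one]
    ext j
    have hj := congrFun h j
    rw [show ((x ᵥ* M.adjugate) ᵥ* M) j = ∑ i, (x ᵥ* M.adjugate) i * M i j from rfl] at hj
    simp only [Fin.sum_univ_three, hM, Pi.smul_apply, smul_eq_mul] at hj
    change _ * (v 1 j - v 0 j) + _ * (v 2 j - v 0 j) + _ * (v 3 j - v 0 j) = _ at hj
    rw [Fin.sum_univ_succ]
    simp [Fin.sum_univ_three, neg_dotProduct, hUx]
    linear_combination s * hj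

open Matrix in

/-- White's theorem: Every empty lattice tetrahedron in `ℝ³` has
lattice width one: there is a nonzero integer linear functional (given by a
coefficient vector `w`) taking exactly two values on the four vertices, which
are consecutive integers `c` and `c+1`; moreover `w` can be chosen constant on
each edge of a pair of opposite edges. -/
theorem empty_tetrahedron_width_one
    (v : Fin 4 → (Fin 3 → ℤ))
    (haff : AffineIndependent ℝ fun i => fun j => ((v i j : ℝ)))
    (hempty : ∀ x : Fin 3 → ℤ,
      (fun i => (x i : ℝ)) ∈ convexHull ℝ (Set.range fun i => fun j => ((v i j : ℝ))) →
      ∃ i, x = v i) :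
    ∃ (w : Fin 3 → ℤ) (c : ℤ), w ≠ 0 ∧
      (∀ i, (∑ j, w j * v i j) = c ∨ (∑ j, w j * v i j) = c + 1) ∧
      (∃ i, (∑ j, w j * v i j) = c) ∧ (∃ i, (∑ j, w j * v i j) = c + 1) ∧
      ∃ σ : Equiv.Perm (Fin 4),
        (∑ j, w j * v (σ 0) j) = (∑ j, w j * v (σ 1) j) ∧
        (∑ j, w j * v (σ 2) j) = (∑ j, w j * v (σ 3) j) := by
  obtain ⟨N, hN, W, hWv, hWsum, hWx⟩ := exists_barycentric_functionals v haff
  let φ : (Fin 3 → ℤ) →+ (Fin 4 → ℤ) :=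
    { toFun := fun x i => W i ⬝ᵥ x
      map_zero' := by ext; simp
      map_add' := fun x y => by ext; simp [dotProduct_add] }
  have hφ : ∀ x i, φ x i = W i ⬝ᵥ x := fun _ _ => rfl
  obtain ⟨p, hp, hdvd⟩ : ∃ p, p ≠ 0 ∧ ∀ a ∈ φ.range, N ∣ a 0 + a p := by
    refine exists_dvd_add hN ?_ ?_ ⟨φ (v 0 - v 1), ⟨_, rfl⟩, ?_⟩
    · rintro _ ⟨x, rfl⟩
      simp_rw [hφ]
      rw [← sum_dotProduct, hWsum, zero_dotProduct]
    · rintro _ ⟨y, rfl⟩ hr i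
      simp_rw [hφ] at hr ⊢
      have hWy : ∑ k, W k ⬝ᵥ y = 0 := by rw [← sum_dotProduct, hWsum, zero_dotProduct]
      have hdiv : ∀ k, W k ⬝ᵥ y % N + N * (W k ⬝ᵥ y / N) = W k ⬝ᵥ y :=
        fun k => Int.emod_add_mul_ediv _ _
      have hquot : ∑ k, W k ⬝ᵥ y / N = -1 := by
        have : ∑ k, W k ⬝ᵥ y % N + N * ∑ k, W k ⬝ᵥ y / N = 0 := by
          rw [Finset.mul_sum, ← Finset.sum_add_distrib, Finset.sum_congr rfl fun k _ => hdiv k, hWy]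
        exact mul_left_cancel₀ hN.ne' (by linear_combination this - hr)
      set z : Fin 3 → ℤ := y - ∑ k, (W k ⬝ᵥ y / N) • v k with hz
      have hzN : N • z = ∑ k, (W k ⬝ᵥ y % N) • v k := by
        rw [hz, smul_sub, ← hWx y, Finset.smul_sum, ← Finset.sum_sub_distrib]
        refine Finset.sum_congr rfl fun k _ => ?_
        rw [smul_smul, ← sub_smul]
        congr 1
        linear_combination -hdiv k
      have hNR : (N : ℝ) ≠ 0 := by exact_mod_cast hN.ne'
      obtain ⟨l, hl⟩ := hempty z <| by
        refine mem_convexHull_of_exists_fintype (fun k => ((W k ⬝ᵥ y % N : ℤ) : ℝ) / N) _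
          (fun k => div_nonneg (by exact_mod_cast Int.emod_nonneg _ hN.ne') (by exact_mod_cast hN.le))
          ?_ (fun k => Set.mem_range_self k) ?_
        · rw [← Finset.sum_div, div_eq_one_iff_eq hNR]
          exact_mod_cast hr
        · ext j
          have hj := congrFun hzN j
          simp only [Pi.smul_apply, smul_eq_mul, Finset.sum_apply] at hj
          simp only [Pi.smul_apply, smul_eq_mul, Finset.sum_apply, div_mul_eq_mul_div]
          rw [← Finset.sum_div, div_eq_iff hNR, mul_comm]
          exact_mod_cast hj.symm
      have hWz : ∀ k, W i ⬝ᵥ v k = W i ⬝ᵥ z +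
          N * ((Pi.single k 1 : Fin 4 → ℤ) i - (Pi.single l 1 : Fin 4 → ℤ) i) := fun k => by
        rw [hl, ← hWv]; ring
      have h1 : W i ⬝ᵥ z = W i ⬝ᵥ y - ∑ k, (W k ⬝ᵥ y / N) * W i ⬝ᵥ v k := by
        rw [hz, dotProduct_sub, dotProduct_sum]
        simp_rw [dotProduct_smul, smul_eq_mul]
      have h2 : W i ⬝ᵥ y = N * ∑ k, (W k ⬝ᵥ y / N) *
          ((Pi.single k 1 : Fin 4 → ℤ) i - (Pi.single l 1 : Fin 4 → ℤ) i) := by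
        simp_rw [hWz, mul_add, Finset.sum_add_distrib, ← Finset.sum_mul, hquot] at h1
        rw [Finset.mul_sum]
        simp_rw [mul_left_comm _ N] at h1
        linear_combination -h1
      exact ⟨_, h2⟩
    · rw [hφ, dotProduct_sub, hWv]
      simp
  have hcoef : ∀ j, N ∣ W 0 j + W p j := fun j => by
    simpa [hφ] using hdvd _ ⟨Pi.single j 1, rfl⟩
  choose w hw using hcoef
  have hwv : ∀ i, N * ∑ j, w j * v i j = W 0 ⬝ᵥ v i + W p ⬝ᵥ v i := fun i => by
    rw [← add_dotProduct, dotProduct, Finset.mul_sum]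
    exact Finset.sum_congr rfl fun j _ => by rw [Pi.add_apply, hw]; ring
  have hdiff : ∀ i k, (∑ j, w j * v i j) - (∑ j, w j * v k j) =
      ((Pi.single i 1 : Fin 4 → ℤ) 0 - (Pi.single k 1 : Fin 4 → ℤ) 0) +
        ((Pi.single i 1 : Fin 4 → ℤ) p - (Pi.single k 1 : Fin 4 → ℤ) p) := fun i k =>
    mul_left_cancel₀ hN.ne' (by linear_combination hwv i - hwv k + hWv 0 i k + hWv p i k)
  obtain ⟨σ, h2, h3⟩ : ∃ σ : Equiv.Perm (Fin 4), σ 2 = 0 ∧ σ 3 = p := by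
    clear hdiff hwv hw hdvd
    revert p; decide
  have hinj : ∀ i k, σ i = σ k ↔ i = k := fun i k => σ.injective.eq_iff
  have hval : ∀ i k, (∑ j, w j * v (σ i) j) - (∑ j, w j * v (σ k) j) =
      (if i = 2 ∨ i = 3 then 1 else 0) - (if k = 2 ∨ k = 3 then 1 else 0) := fun i k => by
    rw [hdiff, ← h2, ← h3]
    simp only [Pi.single_apply, hinj]
    revert i k; decide
  have h10 := hval 1 0
  have h20 := hval 2 0
  have h30 := hval 3 0
  norm_num at h10 h20 h30
  refine ⟨w, ∑ j, w j * v (σ 0) j, ?_, ?_, ⟨σ 0, rfl⟩, ⟨σ 2, by lia⟩, σ, by lia, by lia⟩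
  · rintro rfl
    simp at h20
  · intro i
    obtain ⟨i, rfl⟩ := σ.surjective i
    have := hval i 0
    split_ifs at this <;> lia
end
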